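/- For all positive integers q₁, q₂ and every integer m, the correlation mean value of Ramanujan sums satisfies lim_{N→∞} (1/N) Σ_{n=1}^{N} c_{q₁}(n) c_{q₂}(n + m) = c_{q₁}(m) if q₁ = q₂, and = 0 if q₁ ≠ q₂. -/

import Mathlib

open Finset Filter

/-- The Ramanujan sum `c_q(n) = Σ_{k=1, gcd(k,q)=1}^{q} exp(2πi k n / q)`. -/
noncomputable def ramanujanSum (q : ℕ) (n : ℤ) : ℂ :=
  ∑ k ∈ (Finset.Icc 1 q).filter (fun k => Nat.gcd k q = 1),
    Complex.exp (2 * Real.pi * Complex.I * (k : ℂ) * (n : ℂ) / (q : ℂ))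

theorem ramanujanSum_eq_sum_primitiveRoots {q : ℕ} (hq : 0 < q) (n : ℤ) :
    ramanujanSum q n = ∑ ζ ∈ primitiveRoots q ℂ, ζ ^ n := by
  have : NeZero q := NeZero.of_pos hq
  have hexp := Complex.isPrimitiveRoot_exp q hq.ne'
  unfold ramanujanSum
  refine Finset.sum_bij (fun k _ => Complex.exp (2 * Real.pi * Complex.I / q) ^ k) ?_ ?_ ?_ ?_
  · intro k hk
    rw [Finset.mem_filter] at hk
    exact (mem_primitiveRoots hq).2 (hexp.pow_of_coprime k hk.2)
  · intro i hi j hj hij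
    rw [Finset.mem_filter, Finset.mem_Icc] at hi hj
    have hdvd : (q : ℤ) ∣ j - i := by
      rw [← hexp.zpow_eq_one_iff_dvd, zpow_sub₀ (Complex.exp_ne_zero _), zpow_natCast,
        zpow_natCast, ← hij, div_self (pow_ne_zero _ (Complex.exp_ne_zero _))]
    have := Int.eq_zero_of_abs_lt_dvd hdvd (by rw [abs_lt]; constructor <;> omega)
    omega
  · intro ζ hζ
    obtain ⟨i, hi, hcop, rfl⟩ := hexp.isPrimitiveRoot_iff.1 ((mem_primitiveRoots hq).1 hζ)
    rcases Nat.eq_zero_or_pos i with rfl | hpos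
    · have hq1 : q = 1 := by simpa using hcop
      subst hq1
      exact ⟨1, by simp, by simp⟩
    · exact ⟨i, Finset.mem_filter.2 ⟨Finset.mem_Icc.2 ⟨hpos, hi.le⟩, hcop⟩, rfl⟩
  · intro k _
    rw [← Complex.exp_nat_mul, ← Complex.exp_int_mul]
    congr 1
    ring

theorem tendsto_average_pow {z : ℂ} (hz : ‖z‖ = 1) :
    Tendsto (fun N : ℕ => (N : ℂ)⁻¹ * ∑ n ∈ Finset.Icc 1 N, z ^ n) atTop
      (nhds (if z = 1 then 1 else 0)) := by
  split_ifs with h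
  · subst h
    refine tendsto_const_nhds.congr' ?_
    filter_upwards [eventually_ne_atTop 0] with N hN
    have : (N : ℂ) ≠ 0 := Nat.cast_ne_zero.2 hN
    simp [this]
  · have hz1 : z - 1 ≠ 0 := sub_ne_zero.2 h
    have hsum (N : ℕ) : ∑ n ∈ Finset.Icc 1 N, z ^ n = z * ((z ^ N - 1) / (z - 1)) := by
      rw [← geom_sum_eq h, Finset.mul_sum, ← Finset.Ico_add_one_right_eq_Icc,
        Finset.sum_Ico_eq_sum_range]
      exact Finset.sum_congr rfl fun n _ => by ring
    refine (tendsto_inv_atTop_nhds_zero_nat (𝕜 := ℂ)).zero_mul_isBoundedUnder_le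
      (isBoundedUnder_of ⟨2 / ‖z - 1‖, fun N => ?_⟩)
    simp only [Function.comp_apply, hsum, norm_mul, norm_div, hz, one_mul]
    gcongr
    calc ‖z ^ N - 1‖ ≤ ‖z ^ N‖ + ‖(1 : ℂ)‖ := norm_sub_le _ _
      _ = 2 := by rw [norm_pow, hz]; norm_num

theorem sum_primitiveRoots_ite_mul_eq_one {q₁ q₂ : ℕ} (hq₁ : 0 < q₁) {ω : ℂ}
    (hω : IsPrimitiveRoot ω q₂) (hq₂ : 0 < q₂) :
    ∑ ζ ∈ primitiveRoots q₁ ℂ, (if ζ * ω = 1 then (1 : ℂ) else 0) =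
      if q₁ = q₂ then 1 else 0 := by
  have hω0 : ω ≠ 0 := hω.ne_zero hq₂.ne'
  have hiff : ω⁻¹ ∈ primitiveRoots q₁ ℂ ↔ q₁ = q₂ := by
    rw [mem_primitiveRoots hq₁]
    exact ⟨fun h => h.unique hω.inv, fun h => h ▸ hω.inv⟩
  simp only [mul_eq_one_iff_eq_inv₀ hω0, Finset.sum_ite_eq', hiff]

theorem stmt_3 (q₁ q₂ : ℕ) (hq₁ : 0 < q₁) (hq₂ : 0 < q₂) (m : ℤ) :
    Tendsto (fun N : ℕ => (N : ℂ)⁻¹ *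
        ∑ n ∈ Finset.Icc 1 N, ramanujanSum q₁ (n : ℤ) * ramanujanSum q₂ ((n : ℤ) + m))
      atTop (nhds (if q₁ = q₂ then ramanujanSum q₁ m else 0)) := by
  have hlim : Tendsto (fun N : ℕ => ∑ ω ∈ primitiveRoots q₂ ℂ, ω ^ m *
      ∑ ζ ∈ primitiveRoots q₁ ℂ, (N : ℂ)⁻¹ * ∑ n ∈ Finset.Icc 1 N, (ζ * ω) ^ n) atTop
      (nhds (∑ ω ∈ primitiveRoots q₂ ℂ, ω ^ m *
        ∑ ζ ∈ primitiveRoots q₁ ℂ, if ζ * ω = 1 then (1 : ℂ) else 0)) := by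
    refine tendsto_finsetSum _ fun ω hω => Tendsto.const_mul _ <|
      tendsto_finsetSum _ fun ζ hζ => tendsto_average_pow ?_
    rw [norm_mul, ((mem_primitiveRoots hq₁).1 hζ).norm'_eq_one hq₁.ne',
      ((mem_primitiveRoots hq₂).1 hω).norm'_eq_one hq₂.ne', one_mul]
  have hval : (∑ ω ∈ primitiveRoots q₂ ℂ, ω ^ m *
      ∑ ζ ∈ primitiveRoots q₁ ℂ, if ζ * ω = 1 then (1 : ℂ) else 0) =
      if q₁ = q₂ then ramanujanSum q₁ m else 0 := by
    rw [Finset.sum_congr rfl fun ω hω => by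
      rw [sum_primitiveRoots_ite_mul_eq_one hq₁ ((mem_primitiveRoots hq₂).1 hω) hq₂]]
    split_ifs with h
    · simp [h, ramanujanSum_eq_sum_primitiveRoots hq₂]
    · simp
  rw [← hval]
  refine hlim.congr fun N => ?_
  have hprod (n : ℕ) : ramanujanSum q₁ n * ramanujanSum q₂ (n + m) =
      ∑ ω ∈ primitiveRoots q₂ ℂ, ∑ ζ ∈ primitiveRoots q₁ ℂ, ω ^ m * (ζ * ω) ^ n := by
    rw [ramanujanSum_eq_sum_primitiveRoots hq₁, ramanujanSum_eq_sum_primitiveRoots hq₂,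
      Finset.sum_mul_sum, Finset.sum_comm]
    refine Finset.sum_congr rfl fun ω hω => Finset.sum_congr rfl fun ζ _ => ?_
    rw [zpow_add₀ (((mem_primitiveRoots hq₂).1 hω).ne_zero hq₂.ne'), zpow_natCast, zpow_natCast,
      mul_pow]
    ring
  simp only [hprod]
  rw [Finset.sum_comm, Finset.mul_sum]
  refine Finset.sum_congr rfl fun ω _ => ?_
  rw [Finset.sum_comm, Finset.mul_sum, Finset.mul_sum]
  refine Finset.sum_congr rfl fun ζ _ => ?_
  rw [← Finset.mul_sum]
  ring
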